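/- Let F be the curvature of the standard G₂-instanton connection form A₀, i.e. F(x, y)((u₁, w₁), (u₂, w₂)) = (|x|² + |y|²)⁻² · Im[ |y|²·x⁻¹·(u₁·ū₂ − u₂·ū₁)·x + |x|²·y⁻¹·(w₁·w̄₂ − w₂·w̄₁)·y − 2·(x̄·u₁·w̄₂·y − x̄·u₂·w̄₁·y) ] for x, y ≠ 0. Then: (1) for every unit quaternion q, F(x, y)((u₁·q, w₁·q), (u₂·q, w₂·q)) = F(x, y)((u₁, w₁), (u₂, w₂)); and (2) for every imaginary quaternion p and every (x, y) with x, y ≠ 0, the skew-symmetric endomorphism E of ℝ⁸ defined by ⟨E v, v'⟩ = ⟨p, F(x, y)(v, v')⟩ (Euclidean inner product, using Im ℍ ≅ ℝ³) lies in the infinitesimal stabilizer 𝔞 of Ψ₀. In other words, the 2-form part of F takes values in Lie(Spin(7)), so A₀ is a Spin(7)-instanton. -/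

import Mathlib

/- STATEMENT 13: The curvature F of the standard G₂-instanton is (1) invariant
under the diagonal right action of unit quaternions, and (2) its 2-form part takes
values in Lie(Spin(7)): for every imaginary quaternion p, the skew endomorphism E
with ⟨E v, v'⟩ = ⟨p, F(x,y)(v,v')⟩ lies in the infinitesimal stabilizer 𝔞 of Ψ₀.
Hence A₀ is a Spin(7)-instanton. -/

open Quaternion

noncomputable section

abbrev V8 := ℍ[ℝ] × ℍ[ℝ]

/-- Coordinates of a quaternion in the basis `e₀ = 1, e₁ = −i, e₂ = −j, e₃ = −k`. -/
def qc : Fin 4 → ℍ[ℝ] → ℝ :=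
  ![fun q => q.re, fun q => -q.imI, fun q => -q.imJ, fun q => -q.imK]

def cx (i : Fin 4) : V8 → ℝ := fun p => qc i p.1
def cy (i : Fin 4) : V8 → ℝ := fun p => qc i p.2

def w2 (f g : V8 → ℝ) : V8 → V8 → ℝ := fun u v => f u * g v - f v * g u

def w22 (a b : V8 → V8 → ℝ) : V8 → V8 → V8 → V8 → ℝ := fun v1 v2 v3 v4 =>
  a v1 v2 * b v3 v4 - a v1 v3 * b v2 v4 + a v1 v4 * b v2 v3 +
  a v2 v3 * b v1 v4 - a v2 v4 * b v1 v3 + a v3 v4 * b v1 v2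

def ox1 : V8 → V8 → ℝ := fun u v => w2 (cx 0) (cx 1) u v + w2 (cx 2) (cx 3) u v
def ox2 : V8 → V8 → ℝ := fun u v => w2 (cx 0) (cx 2) u v - w2 (cx 1) (cx 3) u v
def ox3 : V8 → V8 → ℝ := fun u v => w2 (cx 0) (cx 3) u v + w2 (cx 1) (cx 2) u v
def oy1 : V8 → V8 → ℝ := fun u v => w2 (cy 0) (cy 1) u v + w2 (cy 2) (cy 3) u v
def oy2 : V8 → V8 → ℝ := fun u v => w2 (cy 0) (cy 2) u v - w2 (cy 1) (cy 3) u v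
def oy3 : V8 → V8 → ℝ := fun u v => w2 (cy 0) (cy 3) u v + w2 (cy 1) (cy 2) u v

/-- Ψ₀ = dx⁰¹²³ + dy⁰¹²³ + ω₁ˣ∧ω₁ʸ + ω₂ˣ∧ω₂ʸ − ω₃ˣ∧ω₃ʸ. -/
def Psi0 : V8 → V8 → V8 → V8 → ℝ := fun v1 v2 v3 v4 =>
  w22 (w2 (cx 0) (cx 1)) (w2 (cx 2) (cx 3)) v1 v2 v3 v4 +
  w22 (w2 (cy 0) (cy 1)) (w2 (cy 2) (cy 3)) v1 v2 v3 v4 +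
  w22 ox1 oy1 v1 v2 v3 v4 + w22 ox2 oy2 v1 v2 v3 v4 - w22 ox3 oy3 v1 v2 v3 v4

/-- The Euclidean inner product on ℝ⁸ ≅ ℍ × ℍ. -/
def dot (u v : V8) : ℝ := (u.1 * star v.1).re + (u.2 * star v.2).re

/-- The curvature of the standard G₂-instanton connection form A₀. -/
def Fc (x y : ℍ[ℝ]) : V8 → V8 → ℍ[ℝ] := fun t1 t2 =>
  (((‖x‖ ^ 2 + ‖y‖ ^ 2) ^ 2)⁻¹ : ℝ) •
    ((‖y‖ ^ 2 : ℝ) • (x⁻¹ * (t1.1 * star t2.1 - t2.1 * star t1.1) * x) +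
        (‖x‖ ^ 2 : ℝ) • (y⁻¹ * (t1.2 * star t2.2 - t2.2 * star t1.2) * y) -
        (2 : ℝ) • (star x * t1.1 * star t2.2 * y - star x * t2.1 * star t1.2 * y)).im

/-- Diagonal right multiplication of `ℍ²` by a quaternion. -/
def rightMul (q : ℍ[ℝ]) (v : V8) : V8 := (v.1 * q, v.2 * q)

lemma Fc_rightMul_left (x y q : ℍ[ℝ]) (v v' : V8) :
    Fc x y (rightMul q v) v' = Fc x y v (rightMul (star q) v') := by
  simp only [Fc, rightMul, star_mul, star_star, mul_assoc]

lemma Fc_swap (x y : ℍ[ℝ]) (v v' : V8) : Fc x y v v' = -Fc x y v' v := by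
  simp only [Fc]
  rw [← smul_neg, ← Quaternion.im_neg]
  congr 2
  rw [← neg_sub (v'.1 * star v.1), ← neg_sub (v'.2 * star v.2),
    ← neg_sub (star x * v'.1 * star v.2 * y)]
  simp only [mul_neg, neg_mul, smul_neg]
  abel

lemma rightMul_star_rightMul {q : ℍ[ℝ]} (hq : ‖q‖ = 1) (v : V8) :
    rightMul (star q) (rightMul q v) = v := by
  have h : q * star q = 1 := by
    rw [Quaternion.self_mul_star, Quaternion.normSq_eq_norm_mul_self, hq]
    simp
  simp [rightMul, mul_assoc, h]

lemma dot_comm (u v : V8) : dot u v = dot v u := by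
  simp only [dot, Quaternion.re_mul, Quaternion.re_star, Quaternion.imI_star,
    Quaternion.imJ_star, Quaternion.imK_star]
  ring

lemma dot_rightMul_left (q : ℍ[ℝ]) (u v : V8) :
    dot (rightMul q u) v = dot u (rightMul (star q) v) := by
  simp only [dot, rightMul, star_mul, star_star, mul_assoc]

/-- The 2-form on `ℍ²` associated with right multiplication by `e`. -/
def rightForm (e : ℍ[ℝ]) (u v : V8) : ℝ := dot (rightMul e u) v

/-- The antisymmetrization of `B ⊗ B`, which for a 2-form `B` is half of `B ∧ B`. -/
def halfWedgeSq (B : V8 → V8 → ℝ) (v1 v2 v3 v4 : V8) : ℝ :=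
  B v1 v2 * B v3 v4 - B v1 v3 * B v2 v4 + B v1 v4 * B v2 v3

lemma rightForm_apply (e : ℍ[ℝ]) (u v : V8) :
    rightForm e u v = e.re * dot u v - e.imI * (ox1 u v + oy1 u v) -
      e.imJ * (ox2 u v + oy2 u v) - e.imK * (ox3 u v + oy3 u v) := by
  simp [rightForm, rightMul, dot, ox1, oy1, ox2, oy2, ox3, oy3, w2, cx, cy, qc]
  ring

lemma rightForm_neg_i (u v : V8) : rightForm ⟨0, -1, 0, 0⟩ u v = ox1 u v + oy1 u v := by
  refine (rightForm_apply _ u v).trans ?_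
  change 0 * dot u v - (-1) * (ox1 u v + oy1 u v) - 0 * (ox2 u v + oy2 u v) -
    0 * (ox3 u v + oy3 u v) = _
  ring

lemma rightForm_neg_j (u v : V8) : rightForm ⟨0, 0, -1, 0⟩ u v = ox2 u v + oy2 u v := by
  refine (rightForm_apply _ u v).trans ?_
  change 0 * dot u v - 0 * (ox1 u v + oy1 u v) - (-1) * (ox2 u v + oy2 u v) -
    0 * (ox3 u v + oy3 u v) = _
  ring

lemma rightForm_neg_k (u v : V8) : rightForm ⟨0, 0, 0, -1⟩ u v = ox3 u v + oy3 u v := by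
  refine (rightForm_apply _ u v).trans ?_
  change 0 * dot u v - 0 * (ox1 u v + oy1 u v) - 0 * (ox2 u v + oy2 u v) -
    (-1) * (ox3 u v + oy3 u v) = _
  ring

lemma halfWedgeSq_add (A B : V8 → V8 → ℝ) (v1 v2 v3 v4 : V8) :
    halfWedgeSq (fun u v => A u v + B u v) v1 v2 v3 v4 =
      halfWedgeSq A v1 v2 v3 v4 + halfWedgeSq B v1 v2 v3 v4 + w22 A B v1 v2 v3 v4 := by
  simp only [halfWedgeSq, w22]
  ring

lemma halfWedgeSq_sub (A B : V8 → V8 → ℝ) (v1 v2 v3 v4 : V8) :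
    halfWedgeSq (fun u v => A u v - B u v) v1 v2 v3 v4 =
      halfWedgeSq A v1 v2 v3 v4 + halfWedgeSq B v1 v2 v3 v4 - w22 A B v1 v2 v3 v4 := by
  simp only [halfWedgeSq, w22]
  ring

/-- The Plücker relation. -/
lemma halfWedgeSq_w2 (f g : V8 → ℝ) (v1 v2 v3 v4 : V8) :
    halfWedgeSq (w2 f g) v1 v2 v3 v4 = 0 := by
  simp only [halfWedgeSq, w2]
  ring

lemma w22_w2_swap (f g h k : V8 → ℝ) (v1 v2 v3 v4 : V8) :
    w22 (w2 f h) (w2 g k) v1 v2 v3 v4 = -w22 (w2 f g) (w2 h k) v1 v2 v3 v4 := by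
  simp only [w22, w2]
  ring

lemma w22_w2_rotate (f g h k : V8 → ℝ) (v1 v2 v3 v4 : V8) :
    w22 (w2 f k) (w2 g h) v1 v2 v3 v4 = w22 (w2 f g) (w2 h k) v1 v2 v3 v4 := by
  simp only [w22, w2]
  ring

lemma Psi0_eq_halfWedgeSq (v1 v2 v3 v4 : V8) :
    Psi0 v1 v2 v3 v4 =
      halfWedgeSq (rightForm ⟨0, -1, 0, 0⟩) v1 v2 v3 v4 +
        halfWedgeSq (rightForm ⟨0, 0, -1, 0⟩) v1 v2 v3 v4 -
          halfWedgeSq (rightForm ⟨0, 0, 0, -1⟩) v1 v2 v3 v4 := by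
  rw [funext₂ rightForm_neg_i, funext₂ rightForm_neg_j, funext₂ rightForm_neg_k]
  have hx1 : halfWedgeSq ox1 v1 v2 v3 v4 = _ := halfWedgeSq_add _ _ v1 v2 v3 v4
  have hy1 : halfWedgeSq oy1 v1 v2 v3 v4 = _ := halfWedgeSq_add _ _ v1 v2 v3 v4
  have hx2 : halfWedgeSq ox2 v1 v2 v3 v4 = _ := halfWedgeSq_sub _ _ v1 v2 v3 v4
  have hy2 : halfWedgeSq oy2 v1 v2 v3 v4 = _ := halfWedgeSq_sub _ _ v1 v2 v3 v4
  have hx3 : halfWedgeSq ox3 v1 v2 v3 v4 = _ := halfWedgeSq_add _ _ v1 v2 v3 v4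
  have hy3 : halfWedgeSq oy3 v1 v2 v3 v4 = _ := halfWedgeSq_add _ _ v1 v2 v3 v4
  simp only [halfWedgeSq_add, hx1, hy1, hx2, hy2, hx3, hy3, halfWedgeSq_w2,
    w22_w2_swap _ (cx 1) (cx 2), w22_w2_swap _ (cy 1) (cy 2),
    w22_w2_rotate _ (cx 1) (cx 2) (cx 3), w22_w2_rotate _ (cy 1) (cy 2) (cy 3), Psi0]
  ring

lemma halfWedgeSq_derivation_eq_zero {B : V8 → V8 → ℝ} {E : V8 → V8}
    (h : ∀ u v, B (E u) v = -B u (E v)) (v1 v2 v3 v4 : V8) :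
    halfWedgeSq B (E v1) v2 v3 v4 + halfWedgeSq B v1 (E v2) v3 v4 +
      halfWedgeSq B v1 v2 (E v3) v4 + halfWedgeSq B v1 v2 v3 (E v4) = 0 := by
  simp only [halfWedgeSq, h]
  ring

theorem curvature_Sp1r_invariant_and_spin7_valued :
    (∀ x y : ℍ[ℝ], x ≠ 0 → y ≠ 0 → ∀ q : ℍ[ℝ], ‖q‖ = 1 →
      ∀ u1 w1 u2 w2 : ℍ[ℝ],
        Fc x y (u1 * q, w1 * q) (u2 * q, w2 * q) = Fc x y (u1, w1) (u2, w2)) ∧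
    (∀ p : ℍ[ℝ], p.re = 0 → ∀ x y : ℍ[ℝ], x ≠ 0 → y ≠ 0 →
      ∀ E : V8 →ₗ[ℝ] V8,
        (∀ v v' : V8, dot (E v) v' = (p * star (Fc x y v v')).re) →
        ((∀ v v' : V8, dot (E v) v' = - dot v (E v')) ∧
          ∀ v1 v2 v3 v4 : V8,
            Psi0 (E v1) v2 v3 v4 + Psi0 v1 (E v2) v3 v4 +
              Psi0 v1 v2 (E v3) v4 + Psi0 v1 v2 v3 (E v4) = 0)) := by
  refine ⟨fun x y _ _ q hq u1 w1 u2 w2 => ?_, fun p _ x y _ _ E hE => ?_⟩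
  · change Fc x y (rightMul q (u1, w1)) (rightMul q (u2, w2)) = _
    rw [Fc_rightMul_left, rightMul_star_rightMul hq]
  · have hskew (v v' : V8) : dot (E v) v' = -dot v (E v') := by
      rw [dot_comm v, hE, hE, Fc_swap, star_neg, mul_neg, Quaternion.re_neg]
    have hform (e : ℍ[ℝ]) (u v : V8) : rightForm e (E u) v = -rightForm e u (E v) := by
      rw [rightForm, rightForm, dot_rightMul_left, ← hskew, hE, hE, Fc_rightMul_left]
    refine ⟨hskew, fun v1 v2 v3 v4 => ?_⟩
    simp only [Psi0_eq_halfWedgeSq]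
    linear_combination
      halfWedgeSq_derivation_eq_zero (hform ⟨0, -1, 0, 0⟩) v1 v2 v3 v4 +
        halfWedgeSq_derivation_eq_zero (hform ⟨0, 0, -1, 0⟩) v1 v2 v3 v4 -
          halfWedgeSq_derivation_eq_zero (hform ⟨0, 0, 0, -1⟩) v1 v2 v3 v4
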